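/- Let n ≥ 1, s ≥ 1, and s₁, s₂ > 0 with 1 ≤ s₁ < n/2 + 1 and s₁ + s₂ = s + n/2 + 1. There exists a constant c > 0 (depending only on n, s, s₁, s₂) such that for all Schwartz vector fields u, v : ℝⁿ → ℝⁿ with div u = 0, |⟨Λ^s[(u·∇)v], Λ^s v⟩_{L²}| ≤ c·( ‖u‖_{Ḣ^{s₁}}·‖v‖_{Ḣ^{s₂}} + ‖u‖_{Ḣ^{s₂}}·‖v‖_{Ḣ^{s₁}} )·‖v‖_{Ḣ^s}. -/

import Mathlib

open MeasureTheory Filter SchwartzMap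
open scoped FourierTransform

noncomputable section

abbrev Ell (n : ℕ) := EuclideanSpace ℝ (Fin n)

def eVec (n : ℕ) (i : Fin n) : Ell n := EuclideanSpace.single i 1

/-- coercion of a real-valued function to a complex-valued one -/
def cf {n : ℕ} (f : Ell n → ℝ) : Ell n → ℂ := fun x => (f x : ℂ)

/-- the Fourier multiplier operator `Λ^s` with symbol `|ξ|^s` -/
def Lam {n : ℕ} (s : ℝ) (f : Ell n → ℂ) : Ell n → ℂ :=
  𝓕⁻ (fun ξ => ((‖ξ‖ ^ s : ℝ) : ℂ) * 𝓕 f ξ)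

/-- the partial derivative `∂ᵢ` -/
def pd {n : ℕ} (i : Fin n) (f : Ell n → ℂ) : Ell n → ℂ :=
  fun x => fderiv ℝ f x (eVec n i)

/-- the advection term `(v·∇)w` for complex vector fields -/
def adv {n : ℕ} (v w : Fin n → Ell n → ℂ) : Fin n → Ell n → ℂ :=
  fun l x => ∑ i, v i x * pd i (w l) x

/-- squared homogeneous Sobolev norm of a complex scalar function -/
def HsqC {n : ℕ} (s : ℝ) (f : Ell n → ℂ) : ℝ :=
  ∫ ξ, ‖ξ‖ ^ (2 * s) * ‖𝓕 f ξ‖ ^ 2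

/-- homogeneous Sobolev norm `‖u‖_{Ḣ^s}` of a real vector field -/
def Hnorm {n : ℕ} (s : ℝ) (u : Fin n → Ell n → ℝ) : ℝ :=
  Real.sqrt (∑ l, HsqC s (cf (u l)))

/-- `L²` norm of a complex vector field -/
def vL2 {n : ℕ} (f : Fin n → Ell n → ℂ) : ℝ :=
  Real.sqrt (∑ l, ∫ x, ‖f l x‖ ^ 2)

/-- `L²` pairing `⟨f,g⟩ = Σ_l ∫ f_l g_l` of complex vector fields -/
def Cinner {n : ℕ} (f g : Fin n → Ell n → ℂ) : ℂ :=
  ∑ l, ∫ x, f l x * g l x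

/-- A vector field is divergence free: `Σᵢ ∂ᵢuᵢ = 0`. -/
def DivFree {n : ℕ} (u : Fin n → 𝓢(Ell n, ℝ)) : Prop :=
  ∀ x, ∑ i, fderiv ℝ (fun y => u i y) x (eVec n i) = 0

section Plancherel

variable {V : Type*} [NormedAddCommGroup V] [InnerProductSpace ℝ V] [FiniteDimensional ℝ V]
  [MeasurableSpace V] [BorelSpace V]

/-- The inverse Fourier integral is self-adjoint on integrable functions. -/
theorem integral_fourierInv_mul_eq_of_integrable {a b : V → ℂ} (ha : Integrable a)
    (hb : Integrable b) : ∫ x, 𝓕⁻ a x * b x = ∫ x, a x * 𝓕⁻ b x := by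
  have hc : Continuous fun p : V × V ↦ (-innerₗ V) p.1 p.2 := continuous_inner.neg
  have h := VectorFourier.integral_bilin_fourierIntegral_eq_flip (ContinuousLinearMap.mul ℂ ℂ)
    (L := -innerₗ V) (μ := volume) (ν := volume) Real.continuous_fourierChar hc ha hb
  have hflip : (-innerₗ V).flip = -innerₗ V := by
    ext x y
    simp [real_inner_comm]
  rw [hflip] at h
  exact h

/-- On `L¹ ∩ L²` the `L²` inverse Fourier transform is given by the integral formula. -/
theorem coeFn_fourierInv_toLp_ae_eq {a : V → ℂ} (ha : Integrable a) (ha2 : MemLp a 2) :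
    (𝓕⁻ (ha2.toLp a) : Lp (α := V) ℂ 2) =ᵐ[volume] 𝓕⁻ a := by
  have hcont : Continuous (𝓕⁻ a) :=
    VectorFourier.fourierIntegral_continuous Real.continuous_fourierChar
      (L := -innerₗ V) continuous_inner.neg ha
  refine ae_eq_of_integral_contDiff_smul_eq
    ((Lp.memLp _).locallyIntegrable one_le_two) hcont.locallyIntegrable fun g hg hgs ↦ ?_
  have hgs' : HasCompactSupport (fun x ↦ (g x : ℂ)) := hgs.comp_left (g := Complex.ofReal) rfl
  let G : 𝓢(V, ℂ) := hgs'.toSchwartzMap (Complex.ofRealCLM.contDiff.comp hg)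
  have hG (x) : G x = (g x : ℂ) := rfl
  have h1 := congrArg (fun T : TemperedDistribution V ℂ ↦ T G)
    (Lp.fourierInv_toTemperedDistribution_eq (ha2.toLp a))
  simp only [TemperedDistribution.fourierInv_apply, Lp.toTemperedDistribution_apply] at h1
  simp only [hG, smul_eq_mul] at h1
  simp only [Complex.real_smul]
  rw [← h1]
  calc _ = ∫ x, a x * 𝓕⁻ (G : V → ℂ) x := by
        refine integral_congr_ae ?_
        filter_upwards [ha2.coeFn_toLp] with x hx
        rw [hx, mul_comm, SchwartzMap.fourierInv_coe]
    _ = ∫ x, 𝓕⁻ a x * G x := (integral_fourierInv_mul_eq_of_integrable ha G.integrable).symm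
    _ = _ := by simp only [hG, mul_comm]

theorem conj_fourierInv (a : V → ℂ) (x : V) :
    (starRingEnd ℂ) (𝓕⁻ a x) = 𝓕⁻ (fun ξ ↦ (starRingEnd ℂ) (a (-ξ))) x := by
  rw [Real.fourierInv_eq, Real.fourierInv_eq, ← integral_conj,
    ← integral_neg_eq_self (fun v ↦ _)]
  refine integral_congr_ae (ae_of_all _ fun v ↦ ?_)
  simp [Circle.smul_def, Real.fourierChar_apply, ← Complex.exp_conj, Complex.conj_ofNat]

/-- Plancherel's theorem on `L¹ ∩ L²`, in bilinear form. -/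
theorem integral_fourierInv_mul_fourierInv {a b : V → ℂ} (ha : Integrable a) (ha2 : MemLp a 2)
    (hb : Integrable b) (hb2 : MemLp b 2) :
    ∫ x, 𝓕⁻ a x * 𝓕⁻ b x = ∫ ξ, a ξ * b (-ξ) := by
  set b' : V → ℂ := fun ξ ↦ (starRingEnd ℂ) (b (-ξ)) with hb'
  have hm : MeasurePreserving (fun ξ : V ↦ -ξ) volume volume :=
    Measure.measurePreserving_neg volume
  have hbi : Integrable b' :=
    Complex.conjCLE.toContinuousLinearMap.integrable_comp
      ((hm.integrable_comp hb.aestronglyMeasurable).2 hb)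
  have hbi2 : MemLp b' 2 :=
    (hb2.comp_measurePreserving hm).star
  have h1 : inner ℂ (𝓕⁻ (hbi2.toLp b') : Lp ℂ 2 (volume : Measure V)) (𝓕⁻ (ha2.toLp a)) =
      inner ℂ (hbi2.toLp b') (ha2.toLp a) := by
    rw [← Lp.inner_fourier_eq, FourierTransform.fourier_fourierInv_eq,
      FourierTransform.fourier_fourierInv_eq]
  rw [L2.inner_def, L2.inner_def] at h1
  calc _ = _ := integral_congr_ae ?_
    _ = _ := h1
    _ = _ := integral_congr_ae ?_
  · filter_upwards [coeFn_fourierInv_toLp_ae_eq ha ha2, coeFn_fourierInv_toLp_ae_eq hbi hbi2]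
      with x h1 h2
    rw [h1, h2, RCLike.inner_apply, conj_fourierInv]
    simp [hb']
  · filter_upwards [ha2.coeFn_toLp, hbi2.coeFn_toLp] with x h1 h2
    rw [h1, h2, RCLike.inner_apply]
    simp [hb']

end Plancherel

section Trilinear

open scoped ENNReal

variable {V : Type*} [NormedAddCommGroup V]

/-- The kernel `‖ζ‖ ^ (-a) * ‖η‖ ^ (-b)` restricted to the region `‖ζ‖ ≤ ‖η‖`. -/
noncomputable def lowHighKernel (a b : ℝ) (η ζ : V) : ℝ :=
  if ‖ζ‖ ≤ ‖η‖ then ‖ζ‖ ^ (-a) * ‖η‖ ^ (-b) else 0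

theorem lowHighKernel_nonneg (a b : ℝ) (η ζ : V) : 0 ≤ lowHighKernel a b η ζ := by
  unfold lowHighKernel
  split_ifs <;> positivity

theorem abs_rpow_sub_rpow_le {s x y M : ℝ} (hs : 1 ≤ s) (hx : 0 ≤ x) (hy : 0 ≤ y) (hxM : x ≤ M)
    (hyM : y ≤ M) : |x ^ s - y ^ s| ≤ s * M ^ (s - 1) * |x - y| := by
  have h := (convex_Icc (0 : ℝ) M).norm_image_sub_le_of_norm_deriv_le (𝕜 := ℝ)
    (f := fun t ↦ t ^ s) (C := s * M ^ (s - 1)) (x := y) (y := x)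
    (fun t _ ↦ differentiableAt_id.rpow_const (Or.inr hs)) ?_
    ⟨hy, hyM⟩ ⟨hx, hxM⟩
  · simpa [Real.norm_eq_abs] using h
  · intro t ht
    rw [Real.deriv_rpow_const,
      Real.norm_of_nonneg (mul_nonneg (by linarith) (Real.rpow_nonneg ht.1 _))]
    gcongr
    · exact ht.1
    · exact ht.2

theorem abs_norm_rpow_sub_mul_norm_le {s s₁ s₂ : ℝ} (hs : 1 ≤ s) (ζ η : V) :
    |‖ζ + η‖ ^ s - ‖η‖ ^ s| * ‖η‖ ≤ s * 2 ^ (s - 1) *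
      (lowHighKernel (s₁ - 1) (s₂ - s) η ζ * (‖ζ‖ ^ s₁ * ‖η‖ ^ s₂) +
        lowHighKernel (s₁ - 1) (s₂ - s) ζ η * (‖ζ‖ ^ s₂ * ‖η‖ ^ s₁)) := by
  have h1 := lowHighKernel_nonneg (s₁ - 1) (s₂ - s) η ζ
  have h2 := lowHighKernel_nonneg (s₁ - 1) (s₂ - s) ζ η
  have hs0 : 0 ≤ s := by linarith
  rcases eq_or_ne ζ 0 with rfl | hζ
  · simp only [zero_add, sub_self, abs_zero, zero_mul]
    positivity
  rcases eq_or_ne η 0 with rfl | hη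
  · simp only [norm_zero, mul_zero]
    positivity
  have hζ' : 0 < ‖ζ‖ := norm_pos_iff.2 hζ
  have hη' : 0 < ‖η‖ := norm_pos_iff.2 hη
  have hadd := norm_add_le ζ η
  have hsub : |‖ζ + η‖ - ‖η‖| ≤ ‖ζ‖ := by
    simpa using abs_norm_sub_norm_le (ζ + η) η
  have key {p q : ℝ} (hp : 0 < p) (hq : 0 < q) :
      p ^ (-(s₁ - 1)) * q ^ (-(s₂ - s)) * (p ^ s₁ * q ^ s₂) = p * q ^ s := by
    rw [mul_mul_mul_comm, ← Real.rpow_add hp, ← Real.rpow_add hq]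
    ring_nf
    rw [Real.rpow_one, mul_comm]
  rcases le_or_gt ‖ζ‖ ‖η‖ with h | h
  · have hb := abs_rpow_sub_rpow_le (M := 2 * ‖η‖) hs (norm_nonneg (ζ + η)) hη'.le
      (by linarith) (by linarith)
    have h3 : lowHighKernel (s₁ - 1) (s₂ - s) η ζ * (‖ζ‖ ^ s₁ * ‖η‖ ^ s₂) = ‖ζ‖ * ‖η‖ ^ s := by
      rw [lowHighKernel, if_pos h, key hζ' hη']
    rw [h3]
    calc _ ≤ (s * (2 * ‖η‖) ^ (s - 1) * ‖ζ‖) * ‖η‖ := by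
          gcongr
          exact hb.trans (by gcongr)
      _ = s * 2 ^ (s - 1) * (‖ζ‖ * ‖η‖ ^ s) := by
          rw [Real.mul_rpow two_pos.le hη'.le, Real.rpow_sub_one hη'.ne']
          field_simp
      _ ≤ _ := by
          gcongr
          exact le_add_of_nonneg_right (by positivity)
  · have hb := abs_rpow_sub_rpow_le (M := 2 * ‖ζ‖) hs (norm_nonneg (ζ + η)) hη'.le
      (by linarith) (by linarith)
    have h3 : lowHighKernel (s₁ - 1) (s₂ - s) ζ η * (‖ζ‖ ^ s₂ * ‖η‖ ^ s₁) = ‖η‖ * ‖ζ‖ ^ s := by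
      rw [lowHighKernel, if_pos h.le, mul_comm (‖ζ‖ ^ s₂), key hη' hζ']
    rw [h3]
    calc _ ≤ (s * (2 * ‖ζ‖) ^ (s - 1) * ‖ζ‖) * ‖η‖ := by
          gcongr
          exact hb.trans (by gcongr)
      _ = s * 2 ^ (s - 1) * (‖η‖ * ‖ζ‖ ^ s) := by
          rw [Real.mul_rpow two_pos.le hζ'.le, Real.rpow_sub_one hζ'.ne']
          field_simp
      _ ≤ _ := by
          gcongr
          exact le_add_of_nonneg_left (by positivity)

variable [MeasurableSpace V] [BorelSpace V]

@[fun_prop]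
theorem measurable_lowHighKernel {α : Type*} [MeasurableSpace α] (a b : ℝ) {f g : α → V}
    (hf : Measurable f) (hg : Measurable g) :
    Measurable fun x ↦ lowHighKernel a b (f x) (g x) := by
  unfold lowHighKernel
  exact Measurable.ite (measurableSet_le hg.norm hf.norm) (by fun_prop) measurable_const

variable [NormedSpace ℝ V] [FiniteDimensional ℝ V]

theorem exists_lintegral_lowHighKernel_sq_le (μ : Measure V) [μ.IsAddHaarMeasure] {a b : ℝ}
    (hd : 1 ≤ Module.finrank ℝ V) (hb : 0 < b) (hab : a + b = (Module.finrank ℝ V : ℝ) / 2) :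
    ∃ C : ℝ≥0∞, C ≠ ∞ ∧
      ∀ η : V, ∫⁻ ζ, ENNReal.ofReal (lowHighKernel a b η ζ) ^ (2 : ℝ) ∂μ ≤ C := by
  refine ⟨∫⁻ z in Metric.ball 0 2, ENNReal.ofReal (‖z‖ ^ (-(2 * a))) ∂μ, ?_, fun η ↦ ?_⟩
  · have : IntegrableOn (fun z : V ↦ ‖z‖ ^ (-(2 * a))) (Metric.ball 0 2) μ := by
      refine integrableOn_ball_of_norm_le_rpow hd (α := 2 * a) (C := 1) (by linarith)
        (ae_of_all _ fun z ↦ ?_) (Measurable.aestronglyMeasurable (by fun_prop))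
      rw [one_mul, Real.norm_of_nonneg (by positivity)]
    exact this.lintegral_lt_top.ne
  · rcases eq_or_ne η 0 with rfl | hη
    · have h0 (ζ : V) : lowHighKernel a b 0 ζ = 0 := by
        simp [lowHighKernel, Real.zero_rpow (neg_ne_zero.2 hb.ne')]
      simp [h0]
    have hr : 0 < ‖η‖ := norm_pos_iff.2 hη
    have hmap := Measure.map_addHaar_smul μ hr.ne'
    have hmeas : Measurable fun ζ ↦ ENNReal.ofReal (lowHighKernel a b η ζ) ^ (2 : ℝ) := by
      fun_prop
    have hscale : ∫⁻ ζ, ENNReal.ofReal (lowHighKernel a b η ζ) ^ (2 : ℝ) ∂μ =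
        ENNReal.ofReal (‖η‖ ^ (2 * (a + b))) *
          ∫⁻ z, ENNReal.ofReal (lowHighKernel a b η (‖η‖ • z)) ^ (2 : ℝ) ∂μ := by
      rw [← lintegral_map hmeas (measurable_const_smul ‖η‖), hmap, lintegral_smul_measure,
        smul_eq_mul, ← mul_assoc, ← ENNReal.ofReal_mul (by positivity), hab,
        abs_of_nonneg (by positivity), mul_div_cancel₀ _ two_ne_zero, Real.rpow_natCast,
        mul_inv_cancel₀ (by positivity)]
      simp
    rw [hscale, ← lintegral_const_mul _ (by fun_prop), ← lintegral_indicator measurableSet_ball]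
    refine lintegral_mono fun z ↦ ?_
    have hz : ‖‖η‖ • z‖ = ‖η‖ * ‖z‖ := by rw [norm_smul, norm_norm]
    unfold lowHighKernel
    rw [hz]
    split_ifs with h
    · have hz1 : ‖z‖ ≤ 1 := by
        by_contra! h'
        nlinarith
      rw [Set.indicator_of_mem (by rw [mem_ball_zero_iff]; linarith),
        ENNReal.ofReal_rpow_of_nonneg (by positivity) (by positivity),
        ← ENNReal.ofReal_mul (by positivity)]
      refine ENNReal.ofReal_le_ofReal (le_of_eq ?_)
      rw [Real.mul_rpow hr.le (norm_nonneg z), Real.mul_rpow (by positivity) (by positivity),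
        Real.mul_rpow (by positivity) (by positivity), ← Real.rpow_mul hr.le,
        ← Real.rpow_mul hr.le, ← Real.rpow_mul (norm_nonneg z)]
      have : ‖η‖ ^ (2 * (a + b)) * (‖η‖ ^ (-a * 2) * ‖η‖ ^ (-b * 2)) = 1 := by
        rw [← Real.rpow_add hr, ← Real.rpow_add hr]
        ring_nf
        simp
      rw [show -(2 * a) = -a * 2 by ring]
      linear_combination ‖z‖ ^ (-a * 2) * this
    · simp

/-- Cauchy–Schwarz bound for the trilinear form with kernel `lowHighKernel`. -/
theorem lintegral_lowHighKernel_mul_le (μ : Measure V) [μ.IsAddHaarMeasure] {a b : ℝ}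
    {C : ℝ≥0∞}
    (hC : ∀ η : V, ∫⁻ ζ, ENNReal.ofReal (lowHighKernel a b η ζ) ^ (2 : ℝ) ∂μ ≤ C)
    {F G W : V → ℝ≥0∞} (hF : Measurable F) (hG : Measurable G) (hW : Measurable W) :
    ∫⁻ ξ, ∫⁻ η, ENNReal.ofReal (lowHighKernel a b η (ξ - η)) * (F (ξ - η) * G η * W ξ) ∂μ ∂μ ≤
      C ^ (1 / 2 : ℝ) * ((∫⁻ x, F x ^ (2 : ℝ) ∂μ) ^ (1 / 2 : ℝ) *
        (∫⁻ x, G x ^ (2 : ℝ) ∂μ) ^ (1 / 2 : ℝ)) * (∫⁻ x, W x ^ (2 : ℝ) ∂μ) ^ (1 / 2 : ℝ) := by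
  set P : V × V → ℝ≥0∞ := fun p ↦ F (p.1 - p.2) * W p.1 with hP
  set Q : V × V → ℝ≥0∞ := fun p ↦ ENNReal.ofReal (lowHighKernel a b p.2 (p.1 - p.2)) * G p.2
    with hQ
  have hPm : Measurable P := by fun_prop
  have hQm : Measurable Q := by fun_prop
  have hPi : ∫⁻ p, P p ^ (2 : ℝ) ∂μ.prod μ =
      (∫⁻ x, F x ^ (2 : ℝ) ∂μ) * ∫⁻ x, W x ^ (2 : ℝ) ∂μ := by
    rw [lintegral_prod _ (by fun_prop)]
    simp only [hP, ENNReal.mul_rpow_of_nonneg _ _ zero_le_two]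
    have h (ξ : V) : ∫⁻ η, F (ξ - η) ^ (2 : ℝ) * W ξ ^ (2 : ℝ) ∂μ =
        (∫⁻ x, F x ^ (2 : ℝ) ∂μ) * W ξ ^ (2 : ℝ) := by
      rw [lintegral_mul_const _ (by fun_prop),
        lintegral_sub_left_eq_self (fun x ↦ F x ^ (2 : ℝ))]
    simp only [h]
    rw [lintegral_const_mul _ (by fun_prop)]
  have hQi : ∫⁻ p, Q p ^ (2 : ℝ) ∂μ.prod μ ≤ C * ∫⁻ x, G x ^ (2 : ℝ) ∂μ := by
    rw [lintegral_prod_symm _ (by fun_prop), ← lintegral_const_mul _ (by fun_prop)]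
    refine lintegral_mono fun η ↦ ?_
    simp only [hQ, ENNReal.mul_rpow_of_nonneg _ _ zero_le_two]
    rw [lintegral_mul_const _ (by fun_prop),
      lintegral_sub_right_eq_self (fun ζ ↦ ENNReal.ofReal (lowHighKernel a b η ζ) ^ (2 : ℝ))]
    gcongr
    exact hC η
  calc _ = ∫⁻ p, (P * Q) p ∂μ.prod μ := by
        rw [lintegral_prod _ (by fun_prop)]
        refine lintegral_congr fun ξ ↦ lintegral_congr fun η ↦ ?_
        simp only [hP, hQ, Pi.mul_apply]
        ring
    _ ≤ _ := ENNReal.lintegral_mul_le_Lp_mul_Lq _ Real.HolderConjugate.two_two hPm.aemeasurable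
        hQm.aemeasurable
    _ ≤ ((∫⁻ x, F x ^ (2 : ℝ) ∂μ) * ∫⁻ x, W x ^ (2 : ℝ) ∂μ) ^ (1 / 2 : ℝ) *
        (C * ∫⁻ x, G x ^ (2 : ℝ) ∂μ) ^ (1 / 2 : ℝ) := by
        rw [hPi]
        gcongr
    _ = _ := by
        rw [ENNReal.mul_rpow_of_nonneg _ _ (by norm_num),
          ENNReal.mul_rpow_of_nonneg _ _ (by norm_num)]
        ring

/-- The weighted norm `‖ |ξ| ^ s f ‖_{L²}` as an extended nonnegative real. -/
noncomputable def weightedNorm (μ : Measure V) (s : ℝ) (f : V → ℂ) : ℝ≥0∞ :=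
  (∫⁻ ξ, ENNReal.ofReal (‖ξ‖ ^ s * ‖f ξ‖) ^ (2 : ℝ) ∂μ) ^ (1 / 2 : ℝ)

theorem exists_lintegral_commutator_le (μ : Measure V) [μ.IsAddHaarMeasure] {s s₁ s₂ : ℝ}
    (hd : 1 ≤ Module.finrank ℝ V) (hs : 1 ≤ s) (hs₁ : s₁ < (Module.finrank ℝ V : ℝ) / 2 + 1)
    (hsum : s₁ + s₂ = s + (Module.finrank ℝ V : ℝ) / 2 + 1) :
    ∃ K : ℝ≥0∞, K ≠ ∞ ∧ ∀ f g w : V → ℂ, Measurable f → Measurable g → Measurable w →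
      ∫⁻ ξ, ∫⁻ η, ENNReal.ofReal (|‖ξ‖ ^ s - ‖η‖ ^ s| * ‖η‖ *
          (‖f (ξ - η)‖ * ‖g η‖ * (‖ξ‖ ^ s * ‖w ξ‖))) ∂μ ∂μ ≤
        K * (weightedNorm μ s₁ f * weightedNorm μ s₂ g +
          weightedNorm μ s₂ f * weightedNorm μ s₁ g) * weightedNorm μ s w := by
  obtain ⟨C, hC, hCb⟩ := exists_lintegral_lowHighKernel_sq_le μ (a := s₁ - 1) (b := s₂ - s) hd
    (by linarith) (by linarith)
  refine ⟨ENNReal.ofReal (s * 2 ^ (s - 1)) * C ^ (1 / 2 : ℝ), by finiteness,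
    fun f g w hf hg hw ↦ ?_⟩
  have hs0 : 0 ≤ s := by linarith
  set N : ℝ → (V → ℂ) → V → ℝ≥0∞ := fun t h x ↦ ENNReal.ofReal (‖x‖ ^ t * ‖h x‖) with hN
  set k : V → V → ℝ≥0∞ := fun η ζ ↦ ENNReal.ofReal (lowHighKernel (s₁ - 1) (s₂ - s) η ζ) with hk
  have hNm (t : ℝ) {h : V → ℂ} (hh : Measurable h) : Measurable (N t h) := by fun_prop
  have hpt (ξ η : V) : ENNReal.ofReal (|‖ξ‖ ^ s - ‖η‖ ^ s| * ‖η‖ *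
        (‖f (ξ - η)‖ * ‖g η‖ * (‖ξ‖ ^ s * ‖w ξ‖))) ≤
      ENNReal.ofReal (s * 2 ^ (s - 1)) *
        (k η (ξ - η) * (N s₁ f (ξ - η) * N s₂ g η * N s w ξ) +
          k (ξ - η) η * (N s₁ g η * N s₂ f (ξ - η) * N s w ξ)) := by
    have h1 := lowHighKernel_nonneg (s₁ - 1) (s₂ - s) η (ξ - η)
    have h2 := lowHighKernel_nonneg (s₁ - 1) (s₂ - s) (ξ - η) η
    have h := abs_norm_rpow_sub_mul_norm_le (s₁ := s₁) (s₂ := s₂) hs (ξ - η) η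
    rw [sub_add_cancel] at h
    simp only [hN, hk]
    repeat rw [← ENNReal.ofReal_mul (by positivity)]
    rw [← ENNReal.ofReal_add (by positivity) (by positivity),
      ← ENNReal.ofReal_mul (by positivity)]
    refine ENNReal.ofReal_le_ofReal ((mul_le_mul_of_nonneg_right h (by positivity)).trans_eq ?_)
    ring
  have hswap : ∫⁻ ξ, ∫⁻ η, k (ξ - η) η * (N s₁ g η * N s₂ f (ξ - η) * N s w ξ) ∂μ ∂μ =
      ∫⁻ ξ, ∫⁻ η, k η (ξ - η) * (N s₁ g (ξ - η) * N s₂ f η * N s w ξ) ∂μ ∂μ := by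
    refine lintegral_congr fun ξ ↦ ?_
    rw [← lintegral_sub_left_eq_self _ ξ]
    simp only [sub_sub_cancel]
  have hm1 : Measurable fun p : V × V ↦
      k p.2 (p.1 - p.2) * (N s₁ f (p.1 - p.2) * N s₂ g p.2 * N s w p.1) := by fun_prop
  have hm2 : Measurable fun p : V × V ↦
      k (p.1 - p.2) p.2 * (N s₁ g p.2 * N s₂ f (p.1 - p.2) * N s w p.1) := by fun_prop
  calc _ ≤ ∫⁻ ξ, ∫⁻ η, ENNReal.ofReal (s * 2 ^ (s - 1)) *
        (k η (ξ - η) * (N s₁ f (ξ - η) * N s₂ g η * N s w ξ) +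
          k (ξ - η) η * (N s₁ g η * N s₂ f (ξ - η) * N s w ξ)) ∂μ ∂μ :=
        lintegral_mono fun ξ ↦ lintegral_mono fun η ↦ hpt ξ η
    _ = ENNReal.ofReal (s * 2 ^ (s - 1)) *
        (∫⁻ ξ, ∫⁻ η, k η (ξ - η) * (N s₁ f (ξ - η) * N s₂ g η * N s w ξ) ∂μ ∂μ +
          ∫⁻ ξ, ∫⁻ η, k (ξ - η) η * (N s₁ g η * N s₂ f (ξ - η) * N s w ξ) ∂μ ∂μ) := by
        rw [← lintegral_prod _ hm1.aemeasurable, ← lintegral_prod _ hm2.aemeasurable,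
          ← lintegral_add_left hm1, ← lintegral_const_mul _ (by fun_prop),
          lintegral_prod _ (by fun_prop)]
    _ ≤ _ := by
        rw [hswap]
        have e1 := lintegral_lowHighKernel_mul_le μ hCb (hNm s₁ hf) (hNm s₂ hg) (hNm s hw)
        have e2 := lintegral_lowHighKernel_mul_le μ hCb (hNm s₁ hg) (hNm s₂ hf) (hNm s hw)
        refine (mul_le_mul_right (add_le_add e1 e2) _).trans_eq ?_
        simp only [weightedNorm, hN]
        ring

end Trilinear

section Weights

theorem norm_rpow_le_one_add_pow {V : Type*} [NormedAddCommGroup V] (x : V) {t : ℝ}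
    (ht : 0 ≤ t) : ‖x‖ ^ t ≤ 1 + ‖x‖ ^ ⌈t⌉₊ := by
  rcases le_total ‖x‖ 1 with h | h
  · have := Real.rpow_le_one (norm_nonneg x) h ht
    have := pow_nonneg (norm_nonneg x) ⌈t⌉₊
    linarith
  · have := Real.rpow_le_rpow_of_exponent_le h (Nat.le_ceil t)
    rw [Real.rpow_natCast] at this
    linarith

variable {V : Type*} [NormedAddCommGroup V] [InnerProductSpace ℝ V]

theorem SchwartzMap.exists_norm_rpow_mul_le (f : 𝓢(V, ℂ)) {t : ℝ} (ht : 0 ≤ t) :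
    ∃ B : ℝ, ∀ x, ‖((‖x‖ ^ t : ℝ) : ℂ) * f x‖ ≤ B := by
  obtain ⟨B₀, -, h₀⟩ := f.decay 0 0
  obtain ⟨B₁, -, h₁⟩ := f.decay ⌈t⌉₊ 0
  refine ⟨B₀ + B₁, fun x ↦ ?_⟩
  have h₀ := h₀ x
  have h₁ := h₁ x
  simp only [pow_zero, norm_iteratedFDeriv_zero, one_mul] at h₀ h₁
  rw [norm_mul, Complex.norm_real, Real.norm_of_nonneg (by positivity)]
  calc _ ≤ (1 + ‖x‖ ^ ⌈t⌉₊) * ‖f x‖ := by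
        gcongr
        exact norm_rpow_le_one_add_pow x ht
    _ ≤ _ := by linarith

variable [FiniteDimensional ℝ V] [MeasurableSpace V] [BorelSpace V]

theorem SchwartzMap.integrable_norm_rpow_mul (f : 𝓢(V, ℂ)) {t : ℝ} (ht : 0 ≤ t) :
    Integrable fun x ↦ ((‖x‖ ^ t : ℝ) : ℂ) * f x := by
  refine ((f.integrable (μ := volume)).norm.add (f.integrable_pow_mul volume ⌈t⌉₊)).mono'
    (Measurable.aestronglyMeasurable
      (by have := f.continuous.measurable; fun_prop)) (ae_of_all _ fun x ↦ ?_)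
  rw [norm_mul, Complex.norm_real, Real.norm_of_nonneg (by positivity)]
  calc _ ≤ (1 + ‖x‖ ^ ⌈t⌉₊) * ‖f x‖ := by
        gcongr
        exact norm_rpow_le_one_add_pow x ht
    _ = _ := by simp only [Pi.add_apply]; ring

theorem SchwartzMap.memLp_two_norm_rpow_mul (f : 𝓢(V, ℂ)) {t : ℝ} (ht : 0 ≤ t) :
    MemLp (fun x ↦ ((‖x‖ ^ t : ℝ) : ℂ) * f x) 2 := by
  have hi := f.integrable_norm_rpow_mul ht
  obtain ⟨B, hB⟩ := f.exists_norm_rpow_mul_le ht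
  rw [memLp_two_iff_integrable_sq_norm hi.aestronglyMeasurable]
  refine (hi.norm.const_mul B).mono' (hi.aestronglyMeasurable.norm.pow 2) (ae_of_all _ fun x ↦ ?_)
  rw [Real.norm_of_nonneg (by positivity), pow_two]
  gcongr
  exact hB x

theorem weightedNorm_eq_ofReal_sqrt (f : 𝓢(V, ℂ)) {t : ℝ} (ht : 0 ≤ t) :
    weightedNorm volume t f =
      ENNReal.ofReal (Real.sqrt (∫ ξ, ‖ξ‖ ^ (2 * t) * ‖f ξ‖ ^ 2)) := by
  have h := (memLp_two_iff_integrable_sq_norm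
    (f.integrable_norm_rpow_mul ht).aestronglyMeasurable).1 (f.memLp_two_norm_rpow_mul ht)
  have hsq (ξ : V) : ‖((‖ξ‖ ^ t : ℝ) : ℂ) * f ξ‖ ^ 2 = ‖ξ‖ ^ (2 * t) * ‖f ξ‖ ^ 2 := by
    rw [norm_mul, Complex.norm_real, Real.norm_of_nonneg (by positivity), mul_pow,
      mul_comm 2 t, Real.rpow_mul (norm_nonneg ξ), Real.rpow_two]
  simp only [hsq] at h
  have h0 : 0 ≤ ∫ ξ, ‖ξ‖ ^ (2 * t) * ‖f ξ‖ ^ 2 := integral_nonneg fun ξ ↦ by positivity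
  rw [Real.sqrt_eq_rpow, ← ENNReal.ofReal_rpow_of_nonneg h0 (by norm_num),
    ofReal_integral_eq_lintegral_ofReal h (ae_of_all _ fun ξ ↦ by positivity), weightedNorm]
  congr 1
  refine lintegral_congr fun ξ ↦ ?_
  rw [ENNReal.ofReal_rpow_of_nonneg (by positivity) (by norm_num), ← hsq, norm_mul,
    Complex.norm_real, Real.norm_of_nonneg (by positivity), Real.rpow_two]

theorem weightedNorm_comp_neg (t : ℝ) (f : V → ℂ) :
    weightedNorm volume t (fun ξ ↦ f (-ξ)) = weightedNorm volume t f := by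
  unfold weightedNorm
  rw [← lintegral_neg_eq_self (fun ξ ↦ ENNReal.ofReal (‖ξ‖ ^ t * ‖f ξ‖) ^ (2 : ℝ))]
  simp only [norm_neg]

theorem SchwartzMap.integrable_trilinear (f g h : 𝓢(V, ℂ)) {p q : ℝ} (hp : 0 ≤ p) (hq : 0 ≤ q) :
    Integrable (fun z : V × V ↦ f (z.1 - z.2) *
      ((((‖z.1‖ ^ p : ℝ) : ℂ) * h z.1) * (((‖z.2‖ ^ q : ℝ) : ℂ) * g z.2)))
      (volume.prod volume) := by
  obtain ⟨B, -, hB⟩ := f.decay 0 0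
  refine Integrable.bdd_mul (c := B)
    ((h.integrable_norm_rpow_mul hp).mul_prod (g.integrable_norm_rpow_mul hq))
    (Continuous.aestronglyMeasurable (by fun_prop)) (ae_of_all _ fun z ↦ ?_)
  simpa using hB (z.1 - z.2)

theorem SchwartzMap.fourierInv_apply_eq_fourier_neg (f : 𝓢(V, ℂ)) (ξ : V) :
    𝓕⁻ f ξ = 𝓕 f (-ξ) := by
  rw [fourierInv_apply_eq]
  simp

/-- The Fourier transform of a product of Schwartz functions is the convolution. -/
theorem SchwartzMap.fourier_pairing_mul_apply (f g : 𝓢(V, ℂ)) (ξ : V) :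
    𝓕 (pairing (ContinuousLinearMap.mul ℂ ℂ) f g) ξ = ∫ η, 𝓕 f (ξ - η) * 𝓕 g η := by
  have h1 : convolution (ContinuousLinearMap.mul ℂ ℂ) (𝓕⁻ f) (𝓕⁻ g) =
      𝓕⁻ (pairing (ContinuousLinearMap.mul ℂ ℂ) f g) := by
    simp [convolution]
  have hneg (k : 𝓢(V, ℂ)) (x : V) : 𝓕 k x = 𝓕⁻ k (-x) := by
    rw [fourierInv_apply_eq_fourier_neg, neg_neg]
  rw [hneg, ← h1, convolution_apply, convolution_eq_swap, ← integral_neg_eq_self]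
  refine integral_congr_ae (ae_of_all _ fun η ↦ ?_)
  simp only [ContinuousLinearMap.mul_apply']
  rw [hneg, hneg]
  congr 2
  abel

end Weights

section Advection

open scoped LineDeriv
open Complex (I)

variable {n : ℕ}

/-- The complexification of a real-valued Schwartz function. -/
def SchwartzMap.complexify (f : 𝓢(Ell n, ℝ)) : 𝓢(Ell n, ℂ) :=
  postcompCLM Complex.ofRealCLM f

/-- The transport term `(u·∇)w` of a scalar Schwartz function. -/
def SchwartzMap.advection (u : Fin n → 𝓢(Ell n, ℂ)) (w : 𝓢(Ell n, ℂ)) : 𝓢(Ell n, ℂ) :=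
  ∑ i, pairing (ContinuousLinearMap.mul ℂ ℂ) (u i) (∂_{eVec n i} w)

theorem SchwartzMap.coe_advection (u w : Fin n → 𝓢(Ell n, ℂ)) (l : Fin n) :
    ⇑(advection u (w l)) = adv (fun i ↦ ⇑(u i)) (fun l' ↦ ⇑(w l')) l := by
  ext x
  simp [advection, adv, pd, lineDerivOp_apply_eq_fderiv]

theorem SchwartzMap.fourier_lineDerivOp_eVec_apply (w : 𝓢(Ell n, ℂ)) (i : Fin n) (η : Ell n) :
    𝓕 (∂_{eVec n i} w) η = 2 * Real.pi * I * (η i : ℂ) * 𝓕 w η := by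
  rw [fourier_lineDerivOp_eq, smul_apply, smulLeftCLM_apply_apply (by fun_prop)]
  simp [eVec, EuclideanSpace.inner_single_right, mul_assoc]

theorem SchwartzMap.sum_coord_mul_fourier_eq_zero {u : Fin n → 𝓢(Ell n, ℂ)}
    (hu : ∑ i, ∂_{eVec n i} (u i) = 0) (ζ : Ell n) : ∑ i, (ζ i : ℂ) * 𝓕 (u i) ζ = 0 := by
  have h : ∑ i, 𝓕 (∂_{eVec n i} (u i)) ζ = 0 := by
    have := congrArg (fun k : 𝓢(Ell n, ℂ) ↦ FourierTransform.fourierCLM ℂ 𝓢(Ell n, ℂ) k ζ) hu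
    simpa using this
  simp only [fourier_lineDerivOp_eVec_apply, mul_assoc, ← Finset.mul_sum] at h
  simpa [Real.pi_ne_zero] using h

theorem DivFree.sum_lineDerivOp_complexify {u : Fin n → 𝓢(Ell n, ℝ)} (hu : DivFree u) :
    ∑ i, ∂_{eVec n i} (u i).complexify = 0 := by
  ext x
  have h (i : Fin n) : (∂_{eVec n i} (u i).complexify) x =
      ((fderiv ℝ (fun y ↦ u i y) x (eVec n i) : ℝ) : ℂ) := by
    rw [lineDerivOp_apply_eq_fderiv]
    exact congrArg (· (eVec n i))
      ((Complex.ofRealCLM.hasFDerivAt.comp x (u i).differentiableAt.hasFDerivAt).fderiv)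
  simp only [sum_apply, h, ← Complex.ofReal_sum, hu x]
  simp

/-- The integrand of `⟨(u·∇)w, w⟩` on the Fourier side. -/
def advectionSymbol (u : Fin n → 𝓢(Ell n, ℂ)) (w : 𝓢(Ell n, ℂ)) (z : Ell n × Ell n) : ℂ :=
  ∑ i, 𝓕 (u i) (z.1 - z.2) * (𝓕⁻ w z.1 * 𝓕 (∂_{eVec n i} w) z.2)

theorem integrable_norm_rpow_mul_advectionSymbol (u : Fin n → 𝓢(Ell n, ℂ)) (w : 𝓢(Ell n, ℂ))
    {p q : ℝ} (hp : 0 ≤ p) (hq : 0 ≤ q) :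
    Integrable (fun z : Ell n × Ell n ↦
      ((‖z.1‖ ^ p * ‖z.2‖ ^ q : ℝ) : ℂ) * advectionSymbol u w z) (volume.prod volume) := by
  refine (integrable_finsetSum Finset.univ fun i _ ↦
    (𝓕 (u i)).integrable_trilinear (𝓕 (∂_{eVec n i} w)) (𝓕⁻ w) hp hq).congr
    (ae_of_all _ fun z ↦ ?_)
  simp only [advectionSymbol, Finset.mul_sum]
  refine Finset.sum_congr rfl fun i _ ↦ ?_
  push_cast
  ring

theorem advectionSymbol_neg_swap {u : Fin n → 𝓢(Ell n, ℂ)} (hu : ∑ i, ∂_{eVec n i} (u i) = 0)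
    (w : 𝓢(Ell n, ℂ)) (z : Ell n × Ell n) :
    advectionSymbol u w (-z.swap) = -advectionSymbol u w z := by
  have h := sum_coord_mul_fourier_eq_zero hu (z.1 - z.2)
  rw [eq_neg_iff_add_eq_zero]
  simp only [advectionSymbol, fourier_lineDerivOp_eVec_apply, fourierInv_apply_eq_fourier_neg,
    Prod.fst_neg, Prod.snd_neg, Prod.fst_swap, Prod.snd_swap, neg_neg, ← Finset.sum_add_distrib]
  rw [← mul_zero (-(2 * Real.pi * I * 𝓕 w (-z.1) * 𝓕 w z.2)), ← h, Finset.mul_sum]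
  refine Finset.sum_congr rfl fun i _ ↦ ?_
  rw [show -z.2 - -z.1 = z.1 - z.2 by abel]
  simp only [PiLp.sub_apply, PiLp.neg_apply]
  push_cast
  ring

theorem integral_norm_rpow_mul_advectionSymbol_eq_zero {u : Fin n → 𝓢(Ell n, ℂ)}
    (hu : ∑ i, ∂_{eVec n i} (u i) = 0) (w : 𝓢(Ell n, ℂ)) (s : ℝ) :
    ∫ z : Ell n × Ell n, ((‖z.1‖ ^ s * ‖z.2‖ ^ s : ℝ) : ℂ) * advectionSymbol u w z = 0 := by
  set F := fun z : Ell n × Ell n ↦ ((‖z.1‖ ^ s * ‖z.2‖ ^ s : ℝ) : ℂ) * advectionSymbol u w z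
  have h : ∫ z : Ell n × Ell n, F (-z.swap) = ∫ z, F z := by
    have : (volume : Measure (Ell n × Ell n)).IsNegInvariant :=
      ⟨((Measure.measurePreserving_neg volume).prod (Measure.measurePreserving_neg volume)).map_eq⟩
    rw [← integral_neg_eq_self F]
    exact integral_prod_swap (μ := volume) (ν := volume) fun z ↦ F (-z)
  have h' (z : Ell n × Ell n) : F (-z.swap) = -F z := by
    simp only [F, advectionSymbol_neg_swap hu, Prod.fst_neg, Prod.snd_neg, Prod.fst_swap,
      Prod.snd_swap, norm_neg, mul_comm (‖z.2‖ ^ s), mul_neg]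
  simp only [h', integral_neg] at h
  exact self_eq_neg.1 h.symm

theorem SchwartzMap.integrable_sub_left_mul (f g : 𝓢(Ell n, ℂ)) (ξ : Ell n) :
    Integrable fun η ↦ f (ξ - η) * g η := by
  obtain ⟨B, -, hB⟩ := f.decay 0 0
  refine Integrable.bdd_mul (c := B) g.integrable
    (Continuous.aestronglyMeasurable (by fun_prop)) (ae_of_all _ fun η ↦ ?_)
  simpa using hB (ξ - η)

theorem SchwartzMap.fourier_advection_apply (u : Fin n → 𝓢(Ell n, ℂ)) (w : 𝓢(Ell n, ℂ))
    (ξ : Ell n) :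
    𝓕 (advection u w) ξ = ∫ η, ∑ i, 𝓕 (u i) (ξ - η) * 𝓕 (∂_{eVec n i} w) η := by
  rw [integral_finsetSum _ fun i _ ↦ integrable_sub_left_mul _ _ ξ]
  simp only [← fourier_pairing_mul_apply]
  change FourierTransform.fourierCLM ℂ 𝓢(Ell n, ℂ) (advection u w) ξ = _
  simp [advection]

theorem integral_Lam_advection_mul_Lam (u : Fin n → 𝓢(Ell n, ℂ)) (w : 𝓢(Ell n, ℂ)) {s : ℝ}
    (hs : 0 ≤ s) :
    ∫ x, Lam s (advection u w) x * Lam s w x = ∫ z : Ell n × Ell n,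
      ((‖z.1‖ ^ (2 * s) * ‖z.2‖ ^ (0 : ℝ) : ℝ) : ℂ) * advectionSymbol u w z := by
  have h : ∫ x, Lam s (advection u w) x * Lam s w x = _ := integral_fourierInv_mul_fourierInv
    ((𝓕 (advection u w)).integrable_norm_rpow_mul hs)
    ((𝓕 (advection u w)).memLp_two_norm_rpow_mul hs)
    ((𝓕 w).integrable_norm_rpow_mul hs) ((𝓕 w).memLp_two_norm_rpow_mul hs)
  rw [h, Measure.volume_eq_prod, integral_prod _
    (integrable_norm_rpow_mul_advectionSymbol u w (by positivity) le_rfl)]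
  refine integral_congr_ae (ae_of_all _ fun ξ ↦ ?_)
  simp only [Real.rpow_zero, mul_one, integral_const_mul]
  have hsum : ∫ η, advectionSymbol u w (ξ, η) = 𝓕⁻ w ξ * 𝓕 (advection u w) ξ := by
    rw [fourier_advection_apply, ← integral_const_mul]
    refine integral_congr_ae (ae_of_all _ fun η ↦ ?_)
    simp only [advectionSymbol, Finset.mul_sum]
    exact Finset.sum_congr rfl fun i _ ↦ by ring
  rw [hsum, fourierInv_apply_eq_fourier_neg, norm_neg, mul_comm 2 s,
    Real.rpow_mul (norm_nonneg ξ), Real.rpow_two, fourier_coe, fourier_coe]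
  push_cast
  ring

theorem norm_advectionSymbol_le (u : Fin n → 𝓢(Ell n, ℂ)) (w : 𝓢(Ell n, ℂ))
    (z : Ell n × Ell n) :
    ‖advectionSymbol u w z‖ ≤
      ∑ i, 2 * Real.pi * (‖z.2‖ * (‖𝓕 (u i) (z.1 - z.2)‖ * ‖𝓕 w z.2‖ * ‖𝓕 w (-z.1)‖)) := by
  refine norm_sum_le_of_le _ fun i _ ↦ ?_
  have h : ‖z.2 i‖ ≤ ‖z.2‖ := PiLp.norm_apply_le z.2 i
  rw [fourier_lineDerivOp_eVec_apply, fourierInv_apply_eq_fourier_neg]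
  simp only [norm_mul, Complex.norm_I, Complex.norm_real, Complex.norm_ofNat, mul_one,
    Real.norm_of_nonneg Real.pi_pos.le]
  calc _ = 2 * Real.pi * (‖z.2 i‖ * (‖𝓕 (u i) (z.1 - z.2)‖ * ‖𝓕 w z.2‖ * ‖𝓕 w (-z.1)‖)) := by
        ring
    _ ≤ _ := by gcongr

/-- The homogeneous Sobolev norm of a Schwartz function, with values in `[0, ∞]`. -/
abbrev sobolevNorm (t : ℝ) (w : 𝓢(Ell n, ℂ)) : ENNReal :=
  weightedNorm volume t (𝓕 w : 𝓢(Ell n, ℂ))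

theorem exists_enorm_integral_Lam_advection_mul_Lam_le (hn : 1 ≤ n) {s s₁ s₂ : ℝ} (hs : 1 ≤ s)
    (hs₁ : s₁ < (n : ℝ) / 2 + 1) (hsum : s₁ + s₂ = s + (n : ℝ) / 2 + 1) :
    ∃ K : ENNReal, K ≠ ⊤ ∧ ∀ u : Fin n → 𝓢(Ell n, ℂ), ∑ i, ∂_{eVec n i} (u i) = 0 →
      ∀ w : 𝓢(Ell n, ℂ), ‖∫ x, Lam s (advection u w) x * Lam s w x‖ₑ ≤
        ∑ i, K * (sobolevNorm s₁ (u i) * sobolevNorm s₂ w +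
          sobolevNorm s₂ (u i) * sobolevNorm s₁ w) *
            sobolevNorm s w := by
  have hs0 : 0 ≤ s := by linarith
  have hfr : Module.finrank ℝ (Ell n) = n := finrank_euclideanSpace_fin
  obtain ⟨K, hK, hle⟩ := exists_lintegral_commutator_le (volume : Measure (Ell n))
    (s := s) (s₁ := s₁) (s₂ := s₂) (by rwa [hfr]) hs (by rwa [hfr]) (by rwa [hfr])
  refine ⟨ENNReal.ofReal (2 * Real.pi) * K, ENNReal.mul_ne_top ENNReal.ofReal_ne_top hK,
    fun u hu w ↦ ?_⟩
  have hm (k : 𝓢(Ell n, ℂ)) : Measurable k := k.continuous.measurable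
  rw [integral_Lam_advection_mul_Lam u w hs0,
    ← sub_zero (integral _ _), ← integral_norm_rpow_mul_advectionSymbol_eq_zero hu w s,
    Measure.volume_eq_prod, ← integral_sub (integrable_norm_rpow_mul_advectionSymbol u w (by positivity) le_rfl)
      (integrable_norm_rpow_mul_advectionSymbol u w hs0 hs0)]
  let G (i : Fin n) (z : Ell n × Ell n) : ℝ := |‖z.1‖ ^ s - ‖z.2‖ ^ s| * ‖z.2‖ *
    (‖𝓕 (u i) (z.1 - z.2)‖ * ‖𝓕 w z.2‖ * (‖z.1‖ ^ s * ‖𝓕 w (-z.1)‖))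
  have hG (i : Fin n) : Measurable (G i) := by
    have h₁ := hm (𝓕 (u i))
    have h₂ := hm (𝓕 w)
    fun_prop
  have hpt (z : Ell n × Ell n) :
      ‖((‖z.1‖ ^ (2 * s) * ‖z.2‖ ^ (0 : ℝ) : ℝ) : ℂ) * advectionSymbol u w z -
        ((‖z.1‖ ^ s * ‖z.2‖ ^ s : ℝ) : ℂ) * advectionSymbol u w z‖ₑ ≤
      ∑ i, ENNReal.ofReal (2 * Real.pi) * ENNReal.ofReal (G i z) := by
    have hw : ‖z.1‖ ^ (2 * s) * ‖z.2‖ ^ (0 : ℝ) - ‖z.1‖ ^ s * ‖z.2‖ ^ s =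
        ‖z.1‖ ^ s * (‖z.1‖ ^ s - ‖z.2‖ ^ s) := by
      rw [mul_comm 2 s, Real.rpow_mul (norm_nonneg _), Real.rpow_two, Real.rpow_zero]
      ring
    rw [← sub_mul, ← Complex.ofReal_sub, hw, ← ofReal_norm, norm_mul, Complex.norm_real,
      norm_mul, Real.norm_of_nonneg (by positivity : (0 : ℝ) ≤ ‖z.1‖ ^ s), Real.norm_eq_abs]
    simp only [← ENNReal.ofReal_mul (show 0 ≤ 2 * Real.pi by positivity)]
    rw [← ENNReal.ofReal_sum_of_nonneg fun i _ ↦ by positivity]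
    refine ENNReal.ofReal_le_ofReal ?_
    refine (mul_le_mul_of_nonneg_left (norm_advectionSymbol_le u w z) (by positivity)).trans_eq ?_
    rw [Finset.mul_sum]
    exact Finset.sum_congr rfl fun i _ ↦ by simp only [G]; ring
  calc _ ≤ ∫⁻ z : Ell n × Ell n, ∑ i, ENNReal.ofReal (2 * Real.pi) * ENNReal.ofReal (G i z) :=
        (enorm_integral_le_lintegral_enorm _).trans (lintegral_mono hpt)
    _ = ∑ i, ENNReal.ofReal (2 * Real.pi) * ∫⁻ z : Ell n × Ell n, ENNReal.ofReal (G i z) := by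
        rw [lintegral_finsetSum _ fun i _ ↦ ((hG i).ennreal_ofReal.const_mul _)]
        exact Finset.sum_congr rfl fun i _ ↦ lintegral_const_mul _ (hG i).ennreal_ofReal
    _ ≤ _ := by
        refine Finset.sum_le_sum fun i _ ↦ ?_
        rw [Measure.volume_eq_prod, lintegral_prod _ (hG i).ennreal_ofReal.aemeasurable,
          mul_assoc (ENNReal.ofReal _) K, mul_assoc (ENNReal.ofReal _)]
        gcongr
        have := hle _ _ (fun ξ ↦ 𝓕 w (-ξ)) (hm (𝓕 (u i))) (hm (𝓕 w))
          ((hm (𝓕 w)).comp measurable_neg)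
        rwa [weightedNorm_comp_neg] at this

theorem HsqC_nonneg (t : ℝ) (f : Ell n → ℂ) : 0 ≤ HsqC t f :=
  integral_nonneg fun ξ ↦ by positivity

theorem sobolevNorm_complexify_le (u : Fin n → 𝓢(Ell n, ℝ)) {t : ℝ} (ht : 0 ≤ t)
    (i : Fin n) :
    sobolevNorm t (u i).complexify ≤
      ENNReal.ofReal (Hnorm t fun l x ↦ u l x) := by
  rw [sobolevNorm, weightedNorm_eq_ofReal_sqrt _ ht]
  refine ENNReal.ofReal_le_ofReal (Real.sqrt_le_sqrt ?_)
  exact Finset.single_le_sum (f := fun l ↦ HsqC t (cf (u l))) (fun l _ ↦ HsqC_nonneg t _)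
    (Finset.mem_univ i)

end Advection

/-- **Corollary (nonlinear term bound).** For `s ≥ 1`, `1 ≤ s₁ < n/2 + 1`, `s₂ > 0`
with `s₁ + s₂ = s + n/2 + 1`, there is `c > 0` such that for all Schwartz
vector fields `u, v` with `div u = 0`,
`|⟨Λ^s[(u·∇)v], Λ^s v⟩| ≤ c(‖u‖_{Ḣ^{s₁}}‖v‖_{Ḣ^{s₂}} + ‖u‖_{Ḣ^{s₂}}‖v‖_{Ḣ^{s₁}})‖v‖_{Ḣ^s}`. -/
theorem nonlinear_inner_estimate (n : ℕ) (hn : 1 ≤ n) (s s₁ s₂ : ℝ)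
    (hs : 1 ≤ s) (hs₂ : 0 < s₂) (hs₁ : 1 ≤ s₁) (hs₁' : s₁ < (n : ℝ) / 2 + 1)
    (hsum : s₁ + s₂ = s + (n : ℝ) / 2 + 1) :
    ∃ c > (0 : ℝ), ∀ u v : Fin n → 𝓢(Ell n, ℝ), DivFree u →
      ‖Cinner (fun l => Lam s (adv (fun i => cf (u i)) (fun l' => cf (v l')) l))
          (fun l => Lam s (cf (v l)))‖
        ≤ c * (Hnorm s₁ (fun l x => u l x) * Hnorm s₂ (fun l x => v l x)
            + Hnorm s₂ (fun l x => u l x) * Hnorm s₁ (fun l x => v l x))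
            * Hnorm s (fun l x => v l x) := by
  obtain ⟨K, hK, hle⟩ := exists_enorm_integral_Lam_advection_mul_Lam_le hn hs hs₁' hsum
  refine ⟨n * (n * K.toReal) + 1, by positivity, fun u v hu ↦ ?_⟩
  set a₁ := Hnorm s₁ fun l x ↦ u l x
  set a₂ := Hnorm s₂ fun l x ↦ u l x
  set b₁ := Hnorm s₁ fun l x ↦ v l x
  set b₂ := Hnorm s₂ fun l x ↦ v l x
  set b := Hnorm s fun l x ↦ v l x
  have ha₁ : 0 ≤ a₁ := Real.sqrt_nonneg _
  have ha₂ : 0 ≤ a₂ := Real.sqrt_nonneg _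
  have hb₁ : 0 ≤ b₁ := Real.sqrt_nonneg _
  have hb₂ : 0 ≤ b₂ := Real.sqrt_nonneg _
  have hb : 0 ≤ b := Real.sqrt_nonneg _
  have hterm (l : Fin n) : ‖∫ x, Lam s (adv (fun i => cf (u i)) (fun l' => cf (v l')) l) x *
      Lam s (cf (v l)) x‖ ≤ n * (K.toReal * (a₁ * b₂ + a₂ * b₁) * b) := by
    have h := hle (fun i ↦ (u i).complexify) hu.sum_lineDerivOp_complexify (v l).complexify
    rw [coe_advection _ (fun l ↦ (v l).complexify)] at h
    refine (ENNReal.ofReal_le_ofReal_iff (by positivity)).1 ?_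
    rw [ofReal_norm]
    refine h.trans ?_
    calc _ ≤ ∑ _i : Fin n, K * (ENNReal.ofReal a₁ * ENNReal.ofReal b₂ +
            ENNReal.ofReal a₂ * ENNReal.ofReal b₁) * ENNReal.ofReal b := by
          gcongr <;> exact sobolevNorm_complexify_le _ (by linarith) _
      _ = _ := by
          rw [Finset.sum_const, Finset.card_univ, Fintype.card_fin, nsmul_eq_mul,
            ENNReal.ofReal_mul (by positivity), ENNReal.ofReal_mul (by positivity),
            ENNReal.ofReal_mul (by positivity), ENNReal.ofReal_add (by positivity) (by positivity),
            ENNReal.ofReal_mul ha₁, ENNReal.ofReal_mul ha₂, ENNReal.ofReal_natCast,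
            ENNReal.ofReal_toReal hK]
  calc _ ≤ ∑ _l : Fin n, n * (K.toReal * (a₁ * b₂ + a₂ * b₁) * b) :=
        norm_sum_le_of_le _ fun l _ ↦ hterm l
    _ = n * (n * K.toReal) * (a₁ * b₂ + a₂ * b₁) * b := by
        rw [Finset.sum_const, Finset.card_univ, Fintype.card_fin, nsmul_eq_mul]
        ring
    _ ≤ _ := by
        gcongr
        linarith

end
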